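/- There exist constants C_{a,b} > 0 (a, b ∈ ℕ) and a smooth function ρ₁ defined on {(u,ξ) : 0 < ξ ≤ 1, u ≥ ξ} with values in ℂ such that: (i) |(u∂_u)^a (ξ∂_ξ)^b ρ₁(u,ξ)| ≤ C_{a,b} (1 + u^{−2})(1 + u)^{−3} for all a, b ∈ ℕ and all (u,ξ) in the domain; and (ii) for every ξ ∈ (0,1], the function f(x) := h₊(xξ) (1 + ξ² ρ₁(xξ, ξ)) satisfies the eigenvalue equation −f''(x) + (2/(1+x²)) f(x) = ξ² f(x) for all x ≥ 1, and e^{−ixξ} f(x) → 1 as x → +∞. -/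

import Mathlib

noncomputable section

open MeasureTheory Complex Filter

/-- `h₊(u) = e^{iu}(1 + i/u)`. -/
def hplus (u : ℝ) : ℂ := Complex.exp (Complex.I * u) * (1 + Complex.I / u)

/-- The operator `g ↦ u ∂_u g` acting in the first variable. -/
def DU (F : ℝ → ℝ → ℂ) : ℝ → ℝ → ℂ := fun u ξ => (u : ℂ) * deriv (fun v => F v ξ) u

/-- The operator `g ↦ ξ ∂_ξ g` acting in the second variable. -/
def DXI (F : ℝ → ℝ → ℂ) : ℝ → ℝ → ℂ := fun u ξ => (ξ : ℂ) * deriv (fun η => F u η) ξ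

/-! ### A Volterra operator with weight `(s(s - 2i))²` -/

/-- The polynomial `s(s - 2i)`. -/
def jostQ (s : ℝ) : ℂ := (s : ℂ) * ((s : ℂ) - 2 * I)

/-- The weighted average `Q(r)⁻² ∫₀ʳ Q² F`. -/
def weightedMean (F : ℝ → ℂ) (r : ℝ) : ℂ :=
  (jostQ r ^ 2)⁻¹ * ∫ q in (0 : ℝ)..r, jostQ q ^ 2 * F q

/-- The Volterra operator inverting `F ↦ Q⁻² ∂(Q² ∂F)` with zero data at `0`. -/
def volterra (F : ℝ → ℂ) (s : ℝ) : ℂ := ∫ r in (0 : ℝ)..s, weightedMean F r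

lemma continuous_jostQ : Continuous jostQ := by
  unfold jostQ; fun_prop

lemma normSq_jostQ (s : ℝ) : ‖jostQ s‖ ^ 2 = s ^ 2 * (s ^ 2 + 4) := by
  rw [jostQ, norm_mul, mul_pow, ← Complex.normSq_eq_norm_sq, ← Complex.normSq_eq_norm_sq]
  simp [Complex.normSq_apply]
  ring

lemma jostQ_ne_zero {s : ℝ} (hs : s ≠ 0) : jostQ s ≠ 0 := by
  intro h
  have := normSq_jostQ s
  rw [h] at this
  have : 0 < s ^ 2 * (s ^ 2 + 4) := by positivity
  simp_all

lemma normSq_jostQ_mono {q r : ℝ} (h : |q| ≤ |r|) : ‖jostQ q‖ ^ 2 ≤ ‖jostQ r‖ ^ 2 := by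
  rw [normSq_jostQ, normSq_jostQ]
  have := sq_le_sq.mpr h
  gcongr

lemma norm_integral_le_of_norm_le_pow {f : ℝ → ℂ} {c r : ℝ} {m : ℕ}
    (h : ∀ q, |q| ≤ |r| → ‖f q‖ ≤ c * |q| ^ m) :
    ‖∫ q in (0 : ℝ)..r, f q‖ ≤ c * |r| ^ (m + 1) / (m + 1) := by
  have h1 := intervalIntegral.smul_integral_comp_mul_left (a := 0) (b := 1) f r
  rw [mul_zero, mul_one] at h1
  rw [← h1, norm_smul, Real.norm_eq_abs]
  have h2 : ‖∫ x in (0 : ℝ)..1, f (r * x)‖ ≤ ∫ x in (0 : ℝ)..1, c * |r| ^ m * x ^ m := by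
    refine intervalIntegral.norm_integral_le_of_norm_le zero_le_one
      (Filter.Eventually.of_forall fun x hx => ?_)
      (Continuous.intervalIntegrable (by fun_prop) _ _)
    refine (h (r * x) ?_).trans_eq ?_
    · rw [abs_mul, abs_of_pos hx.1]
      exact mul_le_of_le_one_right (abs_nonneg r) hx.2
    · rw [abs_mul, abs_of_pos hx.1, mul_pow]; ring
  rw [intervalIntegral.integral_const_mul, integral_pow] at h2
  calc |r| * ‖∫ x in (0 : ℝ)..1, f (r * x)‖
      ≤ |r| * (c * |r| ^ m * ((1 ^ (m + 1) - 0 ^ (m + 1)) / (m + 1))) := by gcongr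
    _ = c * |r| ^ (m + 1) / (m + 1) := by simp; ring

lemma norm_weightedMean_le {F : ℝ → ℂ} {c r : ℝ} {m : ℕ}
    (h : ∀ q, |q| ≤ |r| → ‖F q‖ ≤ c * |q| ^ m) :
    ‖weightedMean F r‖ ≤ c * |r| ^ (m + 1) / (m + 1) := by
  rw [weightedMean, ← intervalIntegral.integral_const_mul]
  refine norm_integral_le_of_norm_le_pow fun q hq => ?_
  refine le_trans ?_ (h q hq)
  rw [← mul_assoc, norm_mul]
  refine mul_le_of_le_one_left (norm_nonneg _) ?_
  rw [norm_mul, norm_inv, norm_pow, norm_pow, inv_mul_eq_div]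
  exact div_le_one_of_le₀ (normSq_jostQ_mono hq) (by positivity)

lemma norm_volterra_le {F : ℝ → ℂ} {c s : ℝ} {m : ℕ}
    (h : ∀ q, |q| ≤ |s| → ‖F q‖ ≤ c * |q| ^ m) :
    ‖volterra F s‖ ≤ c * |s| ^ (m + 2) / ((m + 1) * (m + 2)) := by
  refine (norm_integral_le_of_norm_le_pow (c := c / (m + 1)) (m := m + 1) fun r hr => ?_).trans_eq ?_
  · exact (norm_weightedMean_le fun q hq => h q (hq.trans hr)).trans_eq (by ring)
  · push_cast
    rw [div_mul_eq_mul_div, div_div]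
    ring

lemma hasDerivAt_jostQ (s : ℝ) : HasDerivAt jostQ (2 * (s : ℂ) - 2 * I) s := by
  have h : HasDerivAt (fun z : ℂ => z * (z - 2 * I)) (2 * (s : ℂ) - 2 * I) (s : ℂ) := by
    refine ((hasDerivAt_id' (s : ℂ)).mul ((hasDerivAt_id' (s : ℂ)).sub_const (2 * I))).congr_deriv ?_
    ring
  exact h.comp_ofReal

lemma hasDerivAt_weightedMean {F : ℝ → ℂ} (hF : Continuous F) {r : ℝ} (hr : r ≠ 0) :
    HasDerivAt (weightedMean F)
      (F r - 2 * (2 * (r : ℂ) - 2 * I) / jostQ r * weightedMean F r) r := by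
  have hQ := jostQ_ne_zero hr
  have h1 : HasDerivAt (fun r : ℝ => ∫ q in (0 : ℝ)..r, jostQ q ^ 2 * F q)
      (jostQ r ^ 2 * F r) r :=
    (Continuous.integral_hasStrictDerivAt ((continuous_jostQ.pow 2).mul hF) 0 r).hasDerivAt
  have h2 := (((hasDerivAt_jostQ r).pow 2).inv (pow_ne_zero 2 hQ)).mul h1
  refine h2.congr_deriv ?_
  simp only [weightedMean, Pi.inv_apply, Pi.pow_apply]
  field_simp
  ring

lemma continuous_weightedMean {F : ℝ → ℂ} (hF : Continuous F) :
    Continuous (weightedMean F) := by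
  rw [continuous_iff_continuousAt]
  intro r
  rcases eq_or_ne r 0 with rfl | hr
  · obtain ⟨K, hK⟩ := (isCompact_Icc (a := (-1 : ℝ)) (b := 1)).exists_bound_of_continuousOn
      hF.continuousOn
    have h0 : weightedMean F 0 = 0 := by simp [weightedMean]
    rw [ContinuousAt, h0]
    refine squeeze_zero_norm' (a := fun r : ℝ => K * |r|) ?_ ?_
    · filter_upwards [Icc_mem_nhds (show (-1 : ℝ) < 0 by norm_num) zero_lt_one] with r hr
      refine (norm_weightedMean_le (c := K) (m := 0) fun q hq => ?_).trans_eq (by simp)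
      simpa using hK q (abs_le.mp (hq.trans (abs_le.mpr hr)))
    · have : Continuous fun r : ℝ => K * |r| := by fun_prop
      simpa using this.tendsto 0
  · exact (hasDerivAt_weightedMean hF hr).continuousAt

lemma hasDerivAt_volterra {F : ℝ → ℂ} (hF : Continuous F) (s : ℝ) :
    HasDerivAt (volterra F) (weightedMean F s) s :=
  (Continuous.integral_hasStrictDerivAt (continuous_weightedMean hF) 0 s).hasDerivAt

lemma continuous_volterra {F : ℝ → ℂ} (hF : Continuous F) : Continuous (volterra F) :=
  continuous_iff_continuousAt.mpr fun s => (hasDerivAt_volterra hF s).continuousAt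

/-- The iterates of the Volterra operator applied to the constant function `1`. -/
def volterraCoeff : ℕ → ℝ → ℂ
  | 0 => fun _ => 1
  | n + 1 => volterra (volterraCoeff n)

lemma continuous_volterraCoeff (n : ℕ) : Continuous (volterraCoeff n) := by
  induction n with
  | zero => exact continuous_const
  | succ n ih => exact continuous_volterra ih

lemma norm_volterraCoeff_le (n : ℕ) (s : ℝ) :
    ‖volterraCoeff n s‖ ≤ ((2 * n).factorial : ℝ)⁻¹ * |s| ^ (2 * n) := by
  induction n generalizing s with
  | zero => simp [volterraCoeff]
  | succ n ih =>
    refine (norm_volterra_le fun q _ => ih q).trans_eq ?_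
    rw [show 2 * (n + 1) = 2 * n + 1 + 1 by ring, Nat.factorial_succ, Nat.factorial_succ]
    push_cast
    field_simp
    ring

/-- A summable majorant for the Neumann series. -/
def neumannBound (K S : ℝ) (n : ℕ) : ℝ := K ^ n * (((2 * n).factorial : ℝ)⁻¹ * S ^ (2 * n))

lemma summable_neumannBound {K : ℝ} (hK : 0 ≤ K) (S : ℝ) : Summable (neumannBound K S) := by
  refine Summable.of_nonneg_of_le (fun n => ?_) (fun n => ?_)
    (Real.summable_pow_div_factorial (K * S ^ 2))
  · unfold neumannBound
    have := (even_two_mul n).pow_nonneg S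
    positivity
  · have h1 : (n.factorial : ℝ) ≤ (2 * n).factorial := by
      exact_mod_cast Nat.factorial_le (by omega)
    have := (even_two_mul n).pow_nonneg S
    calc neumannBound K S n ≤ K ^ n * ((n.factorial : ℝ)⁻¹ * S ^ (2 * n)) := by
          unfold neumannBound; gcongr
      _ = (K * S ^ 2) ^ n / n.factorial := by rw [mul_pow, pow_mul]; ring

lemma norm_pow_mul_volterraCoeff_le {w : ℂ} {K s S : ℝ} (hw : ‖w‖ ≤ K) (hs : |s| ≤ S) (n : ℕ) :
    ‖w ^ n * volterraCoeff n s‖ ≤ neumannBound K S n := by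
  rw [norm_mul, norm_pow]
  have hK := (norm_nonneg w).trans hw
  unfold neumannBound
  gcongr
  exact (norm_volterraCoeff_le n s).trans (by gcongr)

/-- The Neumann series `Σ wⁿ 𝒱ⁿ 1`. -/
def neumann (w : ℂ) (s : ℝ) : ℂ := ∑' n, w ^ n * volterraCoeff n s

lemma hasSum_neumann (w : ℂ) (s : ℝ) :
    HasSum (fun n => w ^ n * volterraCoeff n s) (neumann w s) :=
  (Summable.of_norm_bounded (summable_neumannBound (norm_nonneg w) |s|)
    (norm_pow_mul_volterraCoeff_le le_rfl le_rfl)).hasSum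

lemma continuous_neumann (w : ℂ) : Continuous (neumann w) := by
  rw [continuous_iff_continuousAt]
  intro s
  have h : ContinuousOn (neumann w) (Set.Icc (-(|s| + 1)) (|s| + 1)) :=
    continuousOn_tsum
      (fun n => ((continuous_volterraCoeff n).const_mul (w ^ n)).continuousOn)
      (summable_neumannBound (norm_nonneg w) (|s| + 1))
      (fun n x hx => norm_pow_mul_volterraCoeff_le le_rfl (abs_le.mpr hx) n)
  refine h.continuousAt (Icc_mem_nhds ?_ ?_)
  · linarith [neg_abs_le s]
  · linarith [le_abs_self s]

lemma hasSum_integral_of_norm_le {f : ℕ → ℝ → ℂ} {g : ℝ → ℂ} {u : ℕ → ℝ} {r : ℝ}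
    (hf : ∀ n, Continuous (f n)) (hu : Summable u) (hfu : ∀ n, ∀ q, |q| ≤ |r| → ‖f n q‖ ≤ u n)
    (hg : ∀ q, HasSum (fun n => f n q) (g q)) :
    HasSum (fun n => ∫ q in (0 : ℝ)..r, f n q) (∫ q in (0 : ℝ)..r, g q) := by
  refine intervalIntegral.hasSum_integral_of_dominated_convergence (fun n _ => u n)
    (fun n => (hf n).aestronglyMeasurable) (fun n => Filter.Eventually.of_forall fun q hq => ?_)
    (Filter.Eventually.of_forall fun _ _ => hu) intervalIntegrable_const
    (Filter.Eventually.of_forall fun q _ => hg q)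
  refine hfu n q ?_
  simpa using Set.abs_sub_left_of_mem_uIcc (Set.uIoc_subset_uIcc hq)

lemma hasSum_weightedMean_neumann (w : ℂ) (r : ℝ) :
    HasSum (fun n => w ^ n * weightedMean (volterraCoeff n) r)
      (weightedMean (neumann w) r) := by
  have h : HasSum (fun n => ∫ q in (0 : ℝ)..r, jostQ q ^ 2 * (w ^ n * volterraCoeff n q))
      (∫ q in (0 : ℝ)..r, jostQ q ^ 2 * neumann w q) := by
    refine hasSum_integral_of_norm_le (u := fun n => ‖jostQ r‖ ^ 2 * neumannBound ‖w‖ |r| n)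
      (fun n => ?_) ((summable_neumannBound (norm_nonneg w) |r|).mul_left _) (fun n q hq => ?_)
      (fun q => (hasSum_neumann w q).mul_left _)
    · exact (continuous_jostQ.pow 2).mul ((continuous_volterraCoeff n).const_mul _)
    · rw [norm_mul, norm_pow]
      exact mul_le_mul (normSq_jostQ_mono hq) (norm_pow_mul_volterraCoeff_le le_rfl hq n)
        (norm_nonneg _) (by positivity)
  refine (h.mul_left (jostQ r ^ 2)⁻¹).congr_fun ?_
  intro n
  simp only [weightedMean]
  rw [mul_left_comm, ← intervalIntegral.integral_const_mul]
  congr 2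
  ext q
  ring

lemma norm_weightedMean_volterraCoeff_le {w : ℂ} {r S : ℝ} (hr : |r| ≤ S) (n : ℕ) :
    ‖w ^ n * weightedMean (volterraCoeff n) r‖ ≤ neumannBound ‖w‖ S n * S := by
  have hS := (abs_nonneg r).trans hr
  have h := norm_weightedMean_le (r := r) (fun q _ => norm_volterraCoeff_le n q)
  rw [norm_mul, norm_pow, neumannBound, mul_assoc]
  gcongr
  refine h.trans ?_
  calc ((2 * n).factorial : ℝ)⁻¹ * |r| ^ (2 * n + 1) / ((2 * n : ℕ) + 1)
      ≤ ((2 * n).factorial : ℝ)⁻¹ * |r| ^ (2 * n + 1) := by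
        refine div_le_self (by positivity) ?_
        have : (0 : ℝ) ≤ (2 * n : ℕ) := by positivity
        linarith
    _ ≤ ((2 * n).factorial : ℝ)⁻¹ * S ^ (2 * n + 1) := by gcongr
    _ = _ := by ring

lemma hasSum_volterra_neumann (w : ℂ) (s : ℝ) :
    HasSum (fun n => w ^ n * volterraCoeff (n + 1) s) (volterra (neumann w) s) := by
  have h := hasSum_integral_of_norm_le (r := s)
    (f := fun n r => w ^ n * weightedMean (volterraCoeff n) r)
    (fun n => (continuous_weightedMean (continuous_volterraCoeff n)).const_mul _)
    ((summable_neumannBound (norm_nonneg w) |s|).mul_right |s|)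
    (fun n r hr => norm_weightedMean_volterraCoeff_le hr n)
    (fun r => hasSum_weightedMean_neumann w r)
  simp only [intervalIntegral.integral_const_mul] at h
  exact h

lemma neumann_eq (w : ℂ) (s : ℝ) : neumann w s = 1 + w * volterra (neumann w) s := by
  have h := (hasSum_volterra_neumann w s).mul_left w
  have h1 := (hasSum_neumann w s).tsum_eq
  rw [(hasSum_neumann w s).summable.tsum_eq_zero_add] at h1
  rw [← h1, ← h.tsum_eq]
  simp only [pow_zero, one_mul, volterraCoeff]
  congr 1
  exact tsum_congr fun n => by rw [pow_succ]; ring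

lemma hasDerivAt_neumann (w : ℂ) (s : ℝ) :
    HasDerivAt (neumann w) (w * weightedMean (neumann w) s) s := by
  have h := ((hasDerivAt_volterra (continuous_neumann w) s).const_mul w).const_add 1
  exact h.congr_of_eventuallyEq (Filter.Eventually.of_forall fun s => neumann_eq w s)

lemma differentiable_volterra_neumann (s : ℝ) :
    Differentiable ℂ fun ζ : ℂ => volterra (neumann (-ζ ^ 2)) s := by
  intro ζ
  have h : DifferentiableOn ℂ
      (fun ζ : ℂ => ∑' n, (-ζ ^ 2) ^ n * volterraCoeff (n + 1) s) (Metric.ball 0 (‖ζ‖ + 1)) := by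
    refine Complex.differentiableOn_tsum_of_summable_norm
      (u := fun n => neumannBound ((‖ζ‖ + 1) ^ 2) |s| n * |s| ^ 2)
      ((summable_neumannBound (by positivity) |s|).mul_right _)
      (fun n => ?_) Metric.isOpen_ball (fun n w hw => ?_)
    · fun_prop
    · have hw' : ‖w‖ ≤ ‖ζ‖ + 1 := by simpa using (Metric.mem_ball.mp hw).le
      rw [norm_mul, norm_pow, norm_neg, norm_pow, neumannBound, mul_assoc]
      gcongr
      refine (norm_volterra_le fun q _ => norm_volterraCoeff_le n q).trans ?_
      rw [pow_add, ← mul_assoc]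
      refine div_le_self (by positivity) ?_
      have : (0 : ℝ) ≤ (2 * n : ℕ) := by positivity
      nlinarith
  have h' := h.differentiableAt (x := ζ) (Metric.isOpen_ball.mem_nhds (by simp))
  exact h'.congr_of_eventuallyEq
    (Filter.Eventually.of_forall fun ζ => (hasSum_volterra_neumann _ s).tsum_eq.symm)

/-! ### Energy estimate -/

lemma re_log_deriv_jostQ_nonneg {s : ℝ} (hs : 0 < s) :
    0 ≤ (2 * (2 * (s : ℂ) - 2 * I) / jostQ s).re := by
  rw [Complex.div_re, ← add_div]
  refine div_nonneg ?_ (Complex.normSq_nonneg _)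
  simp [jostQ]
  nlinarith [pow_pos hs 3]

/-- The algebraic inequality behind the energy estimate. -/
lemma energy_inequality (ζ c F G : ℂ) (hc : 0 ≤ c.re) :
    2 * inner ℝ G (-ζ ^ 2 * F - c * G) + ‖ζ‖ ^ 2 * (2 * inner ℝ F G)
      ≤ 2 * |ζ.im| * (‖G‖ ^ 2 + ‖ζ‖ ^ 2 * ‖F‖ ^ 2) := by
  have h1 : 2 * inner ℝ G (-ζ ^ 2 * F - c * G) + ‖ζ‖ ^ 2 * (2 * inner ℝ F G)
      = 2 * ((ζ * (starRingEnd ℂ ζ - ζ)) * F * starRingEnd ℂ G).re - 2 * c.re * ‖G‖ ^ 2 := by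
    rw [Complex.inner, Complex.inner, ← Complex.normSq_eq_norm_sq, ← Complex.normSq_eq_norm_sq]
    simp [Complex.normSq_apply, pow_two]
    ring
  have h2 : ((ζ * (starRingEnd ℂ ζ - ζ)) * F * starRingEnd ℂ G).re
      ≤ 2 * |ζ.im| * (‖G‖ * (‖ζ‖ * ‖F‖)) := by
    refine (Complex.re_le_norm _).trans_eq ?_
    have h3 : starRingEnd ℂ ζ - ζ = ((-2 * ζ.im : ℝ) : ℂ) * I := by
      apply Complex.ext <;> simp; ring
    rw [h3]
    simp only [norm_mul, Complex.norm_I, Complex.norm_real, Real.norm_eq_abs, RCLike.norm_conj,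
      abs_neg]
    norm_num
    ring
  have h4 : 2 * (‖G‖ * (‖ζ‖ * ‖F‖)) ≤ ‖G‖ ^ 2 + ‖ζ‖ ^ 2 * ‖F‖ ^ 2 := by
    nlinarith [sq_nonneg (‖G‖ - ‖ζ‖ * ‖F‖)]
  have h5 := mul_le_mul_of_nonneg_left h4 (show 0 ≤ 2 * |ζ.im| by positivity)
  have h6 : 0 ≤ 2 * c.re * ‖G‖ ^ 2 := by positivity
  rw [h1]
  linarith

lemma norm_neumann_le (ζ : ℂ) {s : ℝ} (hs : 0 ≤ s) :
    ‖neumann (-ζ ^ 2) s‖ ≤ Real.exp (|ζ.im| * s) := by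
  rcases eq_or_ne ζ 0 with rfl | hζ
  · rw [neumann_eq]; simp
  set F := neumann (-ζ ^ 2) with hF
  set G : ℝ → ℂ := fun s => -ζ ^ 2 * weightedMean F s with hG
  have hFc : Continuous F := continuous_neumann _
  have hGc : Continuous G := (continuous_weightedMean hFc).const_mul _
  have hE : ∀ s ∈ Set.Ioi (0 : ℝ), HasDerivAt
      (fun s => Real.exp (-(2 * |ζ.im|) * s) * (‖G s‖ ^ 2 + ‖ζ‖ ^ 2 * ‖F s‖ ^ 2))
      (Real.exp (-(2 * |ζ.im|) * s) *
        (2 * inner ℝ (G s) (-ζ ^ 2 * F s - 2 * (2 * (s : ℂ) - 2 * I) / jostQ s * G s)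
          + ‖ζ‖ ^ 2 * (2 * inner ℝ (F s) (G s))
          - 2 * |ζ.im| * (‖G s‖ ^ 2 + ‖ζ‖ ^ 2 * ‖F s‖ ^ 2))) s := by
    intro s hs
    have h1 : HasDerivAt F (G s) s := hasDerivAt_neumann _ s
    have h2 : HasDerivAt G (-ζ ^ 2 * F s - 2 * (2 * (s : ℂ) - 2 * I) / jostQ s * G s) s := by
      refine ((hasDerivAt_weightedMean hFc (ne_of_gt hs)).const_mul (-ζ ^ 2)).congr_deriv ?_
      simp only [hG]; ring
    have h3 : HasDerivAt (fun s => Real.exp (-(2 * |ζ.im|) * s))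
        (Real.exp (-(2 * |ζ.im|) * s) * -(2 * |ζ.im|)) s := by
      simpa using ((hasDerivAt_id s).const_mul (-(2 * |ζ.im|))).exp
    refine (h3.mul (h2.norm_sq.add (h1.norm_sq.const_mul _))).congr_deriv ?_
    simp only [Pi.add_apply]
    ring
  have hanti : AntitoneOn
      (fun s => Real.exp (-(2 * |ζ.im|) * s) * (‖G s‖ ^ 2 + ‖ζ‖ ^ 2 * ‖F s‖ ^ 2))
      (Set.Ici 0) := by
    refine antitoneOn_of_deriv_nonpos (convex_Ici 0) (by fun_prop) ?_ ?_
    · intro s hs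
      rw [interior_Ici] at hs
      exact (hE s hs).differentiableAt.differentiableWithinAt
    · intro s hs
      rw [interior_Ici] at hs
      rw [(hE s hs).deriv]
      refine mul_nonpos_of_nonneg_of_nonpos (Real.exp_pos _).le (sub_nonpos.mpr ?_)
      exact energy_inequality _ _ _ _ (re_log_deriv_jostQ_nonneg hs)
  have hle := hanti (Set.mem_Ici.mpr le_rfl) (Set.mem_Ici.mpr hs) hs
  have hF0 : F 0 = 1 := by rw [hF, neumann_eq]; simp [volterra]
  have hG0 : G 0 = 0 := by simp [hG, weightedMean]
  simp only [hF0, hG0, mul_zero, Real.exp_zero, norm_zero, norm_one, one_pow, mul_one, one_mul,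
    zero_pow two_ne_zero, zero_add] at hle
  have hζ2 : 0 < ‖ζ‖ ^ 2 := by positivity
  have h1 : Real.exp (-(2 * |ζ.im|) * s) * ‖F s‖ ^ 2 ≤ 1 := by
    have : ‖ζ‖ ^ 2 * (Real.exp (-(2 * |ζ.im|) * s) * ‖F s‖ ^ 2) ≤ ‖ζ‖ ^ 2 * 1 := by
      have : 0 ≤ Real.exp (-(2 * |ζ.im|) * s) * ‖G s‖ ^ 2 := by positivity
      linarith
    exact le_of_mul_le_mul_left this hζ2
  have h2 : ‖F s‖ ^ 2 ≤ Real.exp (|ζ.im| * s) ^ 2 := by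
    rw [← Real.exp_nat_mul]
    rw [neg_mul, Real.exp_neg, inv_mul_le_iff₀ (Real.exp_pos _)] at h1
    refine h1.trans_eq ?_
    rw [mul_one]; congr 1; push_cast; ring
  exact (sq_le_sq₀ (norm_nonneg _) (Real.exp_pos _).le).mp h2

/-! ### The Laplace density of the correction and its derivatives in `ζ` -/

/-- The function `R` with `neumann (-ζ²) s = 1 + ζ² R(s, ζ)`. -/
def jostDensity (s : ℝ) (ζ : ℂ) : ℂ := -volterra (neumann (-ζ ^ 2)) s

lemma neumann_eq_one_add (s : ℝ) (ζ : ℂ) :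
    neumann (-ζ ^ 2) s = 1 + ζ ^ 2 * jostDensity s ζ := by
  rw [neumann_eq, jostDensity]; ring

lemma differentiable_jostDensity (s : ℝ) : Differentiable ℂ (jostDensity s) :=
  (differentiable_volterra_neumann s).neg

lemma norm_weightedMean_neumann_le (ζ : ℂ) {r : ℝ} (hr : 0 ≤ r) :
    ‖weightedMean (neumann (-ζ ^ 2)) r‖ ≤ Real.exp (|ζ.im| * r) * r := by
  rw [weightedMean, ← intervalIntegral.integral_const_mul]
  have h_int : ‖∫ q in (0 : ℝ)..r, (jostQ r ^ 2)⁻¹ * (jostQ q ^ 2 * neumann (-ζ ^ 2) q)‖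
      ≤ Real.exp (|ζ.im| * r) * |r - 0| := by
    refine intervalIntegral.norm_integral_le_of_norm_le_const fun q hq => ?_
    rw [Set.uIoc_of_le hr] at hq
    have h1 : ‖neumann (-ζ ^ 2) q‖ ≤ Real.exp (|ζ.im| * r) := by
      refine (norm_neumann_le ζ hq.1.le).trans ?_
      gcongr
      exact hq.2
    refine le_trans ?_ h1
    rw [← mul_assoc, norm_mul]
    refine mul_le_of_le_one_left (norm_nonneg _) ?_
    rw [norm_mul, norm_inv, norm_pow, norm_pow, inv_mul_eq_div]
    refine div_le_one_of_le₀ (normSq_jostQ_mono ?_) (by positivity)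
    rw [abs_of_pos hq.1, abs_of_nonneg hr]
    exact hq.2
  rwa [sub_zero, abs_of_nonneg hr] at h_int

lemma norm_jostDensity_le {s : ℝ} (hs : 0 ≤ s) (ζ : ℂ) :
    ‖jostDensity s ζ‖ ≤ Real.exp (|ζ.im| * s) * s ^ 2 := by
  rw [jostDensity, norm_neg, volterra]
  have hmean : ∀ r ∈ Set.uIoc 0 s, ‖weightedMean (neumann (-ζ ^ 2)) r‖
      ≤ Real.exp (|ζ.im| * s) * s := by
    intro r hr
    rw [Set.uIoc_of_le hs] at hr
    refine (norm_weightedMean_neumann_le ζ hr.1.le).trans ?_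
    have := hr.2
    have := hr.1.le
    gcongr
  refine (intervalIntegral.norm_integral_le_of_norm_le_const hmean).trans_eq ?_
  rw [sub_zero, abs_of_nonneg hs]
  ring

/-- The `b`-th derivative of `R(s, ·)` at a real point. -/
def jostDensityDeriv (b : ℕ) (s ξ : ℝ) : ℂ := iteratedDeriv b (jostDensity s) (ξ : ℂ)

lemma hasDerivAt_iteratedDeriv_jostDensity (b : ℕ) (s : ℝ) (ζ : ℂ) :
    HasDerivAt (iteratedDeriv b (jostDensity s))
      (iteratedDeriv (b + 1) (jostDensity s) ζ) ζ := by
  rw [iteratedDeriv_succ]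
  have h : ContDiff ℂ ⊤ (jostDensity s) := (differentiable_jostDensity s).contDiff
  exact (h.differentiable_iteratedDeriv b (by simp [lt_top_iff_ne_top]) ζ).hasDerivAt

lemma hasDerivAt_jostDensityDeriv (b : ℕ) (s ξ : ℝ) :
    HasDerivAt (jostDensityDeriv b s) (jostDensityDeriv (b + 1) s ξ) ξ :=
  (hasDerivAt_iteratedDeriv_jostDensity b s ξ).comp_ofReal

lemma norm_jostDensityDeriv_le (b : ℕ) {s : ℝ} (hs : 0 < s) (ξ : ℝ) :
    ‖jostDensityDeriv b s ξ‖ ≤ b.factorial * Real.exp 1 * s ^ (b + 2) := by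
  have h := Complex.norm_iteratedDeriv_le_of_forall_mem_sphere_norm_le (c := (ξ : ℂ))
    (R := s⁻¹) (C := Real.exp 1 * s ^ 2) (f := jostDensity s) b (inv_pos.mpr hs)
    (differentiable_jostDensity s).diffContOnCl ?_
  · refine h.trans_eq ?_
    rw [inv_pow, div_inv_eq_mul]
    ring
  · intro z hz
    refine (norm_jostDensity_le hs.le z).trans ?_
    gcongr
    have h1 : |z.im| ≤ s⁻¹ := by
      have := Complex.abs_im_le_norm (z - ξ)
      rw [mem_sphere_iff_norm] at hz
      rw [hz] at this
      simpa using this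
    calc |z.im| * s ≤ s⁻¹ * s := by gcongr
      _ = 1 := inv_mul_cancel₀ hs.ne'

lemma continuous_jostDensity (ζ : ℂ) : Continuous fun s => jostDensity s ζ :=
  (continuous_volterra (continuous_neumann _)).neg

lemma measurable_iteratedDeriv_jostDensity (b : ℕ) (ζ : ℂ) :
    Measurable fun s => iteratedDeriv b (jostDensity s) ζ := by
  induction b generalizing ζ with
  | zero => simpa using (continuous_jostDensity ζ).measurable
  | succ b ih =>
    have hlim : Tendsto (fun n : ℕ => ζ + ((n : ℂ) + 1)⁻¹) atTop (nhdsWithin ζ {ζ}ᶜ) := by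
      refine tendsto_nhdsWithin_iff.mpr ⟨?_, Filter.Eventually.of_forall fun n => ?_⟩
      · have := (tendsto_one_div_add_atTop_nhds_zero_nat (𝕜 := ℂ)).const_add ζ
        simpa using this
      · have : ((n : ℂ) + 1) ≠ 0 := Nat.cast_add_one_ne_zero n
        simpa using this
    refine measurable_of_tendsto_metrizable
      (f := fun (n : ℕ) s => slope (iteratedDeriv b (jostDensity s)) ζ (ζ + ((n : ℂ) + 1)⁻¹))
      (fun n => ?_) (tendsto_pi_nhds.mpr fun s =>
        (hasDerivAt_iteratedDeriv_jostDensity b s ζ).tendsto_slope.comp hlim)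
    simp only [slope_def_field]
    exact ((ih _).sub (ih _)).div_const _

lemma measurable_jostDensityDeriv (b : ℕ) (ξ : ℝ) :
    Measurable fun s => jostDensityDeriv b s ξ :=
  measurable_iteratedDeriv_jostDensity b ξ

/-! ### Laplace transforms of the density -/

lemma integral_pow_mul_exp_neg_Ioi (n : ℕ) {a : ℝ} (ha : 0 < a) :
    ∫ s in Set.Ioi (0 : ℝ), Real.exp (-(a * s)) * s ^ n = n.factorial / a ^ (n + 1) := by
  have h := Real.integral_rpow_mul_exp_neg_mul_Ioi (a := (n : ℝ) + 1) (by positivity) ha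
  rw [Real.Gamma_nat_eq_factorial] at h
  simp only [add_sub_cancel_right, Real.rpow_natCast] at h
  rw [show ((n : ℝ) + 1) = ((n + 1 : ℕ) : ℝ) by push_cast; rfl, Real.rpow_natCast] at h
  simp_rw [mul_comm (Real.exp _)]
  rw [h, one_div, inv_pow, inv_mul_eq_div]

lemma integrableOn_exp_neg_mul_pow (n : ℕ) {a : ℝ} (ha : 0 < a) :
    IntegrableOn (fun s => Real.exp (-(a * s)) * s ^ n) (Set.Ioi (0 : ℝ)) := by
  refine Integrable.of_integral_ne_zero ?_
  rw [integral_pow_mul_exp_neg_Ioi n ha]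
  positivity

/-- The kernel `e^{-us} sᵏ ∂_ξᵇ R(s, ξ)`. -/
def laplaceKernel (k b : ℕ) (u ξ s : ℝ) : ℂ :=
  ((Real.exp (-(u * s)) * s ^ k : ℝ) : ℂ) * jostDensityDeriv b s ξ

/-- The Laplace transform `∫₀^∞ e^{-us} sᵏ ∂_ξᵇ R(s, ξ) ds`. -/
def laplaceDensity (k b : ℕ) (u ξ : ℝ) : ℂ := ∫ s in Set.Ioi (0 : ℝ), laplaceKernel k b u ξ s

lemma measurable_laplaceKernel (k b : ℕ) (u ξ : ℝ) : Measurable (laplaceKernel k b u ξ) := by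
  have := measurable_jostDensityDeriv b ξ
  unfold laplaceKernel
  fun_prop

lemma norm_laplaceKernel_le (k b : ℕ) {a u s : ℝ} (hau : a ≤ u) (hs : 0 < s) (ξ : ℝ) :
    ‖laplaceKernel k b u ξ s‖
      ≤ b.factorial * Real.exp 1 * (Real.exp (-(a * s)) * s ^ (k + b + 2)) := by
  rw [laplaceKernel, norm_mul, Complex.norm_real, Real.norm_of_nonneg (by positivity)]
  calc Real.exp (-(u * s)) * s ^ k * ‖jostDensityDeriv b s ξ‖
      ≤ Real.exp (-(a * s)) * s ^ k * (b.factorial * Real.exp 1 * s ^ (b + 2)) := by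
        gcongr
        exact norm_jostDensityDeriv_le b hs ξ
    _ = _ := by ring

lemma integrableOn_laplaceKernel (k b : ℕ) {u : ℝ} (hu : 0 < u) (ξ : ℝ) :
    IntegrableOn (laplaceKernel k b u ξ) (Set.Ioi 0) := by
  refine Integrable.mono' ((integrableOn_exp_neg_mul_pow (k + b + 2) hu).const_mul
    (b.factorial * Real.exp 1)) (measurable_laplaceKernel k b u ξ).aestronglyMeasurable ?_
  filter_upwards [ae_restrict_mem measurableSet_Ioi] with s hs
  exact norm_laplaceKernel_le k b le_rfl hs ξ

lemma norm_laplaceDensity_le (k b : ℕ) {u : ℝ} (hu : 0 < u) (ξ : ℝ) :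
    ‖laplaceDensity k b u ξ‖
      ≤ b.factorial * Real.exp 1 * ((k + b + 2).factorial / u ^ (k + b + 3)) := by
  rw [← integral_pow_mul_exp_neg_Ioi (k + b + 2) hu, ← integral_const_mul]
  refine norm_integral_le_of_norm_le ((integrableOn_exp_neg_mul_pow (k + b + 2) hu).const_mul _) ?_
  filter_upwards [ae_restrict_mem measurableSet_Ioi] with s hs
  exact norm_laplaceKernel_le k b le_rfl hs ξ

/-- The linear map `(v, η) ↦ v * z + η * w`. -/
def pairing (z w : ℂ) : ℝ × ℝ →L[ℝ] ℂ :=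
  ContinuousLinearMap.smulRightL ℝ (ℝ × ℝ) ℂ (ContinuousLinearMap.fst ℝ ℝ ℝ) z +
    ContinuousLinearMap.smulRightL ℝ (ℝ × ℝ) ℂ (ContinuousLinearMap.snd ℝ ℝ ℝ) w

lemma pairing_apply (z w : ℂ) (p : ℝ × ℝ) : pairing z w p = p.1 * z + p.2 * w := by
  simp [pairing]

lemma norm_pairing_le (z w : ℂ) : ‖pairing z w‖ ≤ ‖z‖ + ‖w‖ := by
  refine ContinuousLinearMap.opNorm_le_bound _ (by positivity) fun p => ?_
  rw [pairing_apply, add_mul]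
  refine (norm_add_le _ _).trans ?_
  rw [norm_mul, norm_mul, Complex.norm_real, Complex.norm_real, mul_comm ‖z‖, mul_comm ‖w‖]
  gcongr
  · exact norm_fst_le p
  · exact norm_snd_le p

lemma hasFDerivAt_laplaceKernel (k b : ℕ) (s : ℝ) (p : ℝ × ℝ) :
    HasFDerivAt (fun p : ℝ × ℝ => laplaceKernel k b p.1 p.2 s)
      (pairing (-laplaceKernel (k + 1) b p.1 p.2 s) (laplaceKernel k (b + 1) p.1 p.2 s)) p := by
  have h1 : HasDerivAt (fun u : ℝ => ((Real.exp (-(u * s)) * s ^ k : ℝ) : ℂ))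
      ((-(Real.exp (-(p.1 * s)) * s ^ (k + 1)) : ℝ) : ℂ) p.1 := by
    refine HasDerivAt.ofReal_comp ?_
    refine ((((hasDerivAt_id p.1).mul_const s).neg.exp).mul_const (s ^ k)).congr_deriv ?_
    simp; ring
  have h2 := (h1.hasFDerivAt.comp p (hasFDerivAt_fst (𝕜 := ℝ))).mul
    ((hasDerivAt_jostDensityDeriv b s p.2).hasFDerivAt.comp p (hasFDerivAt_snd (𝕜 := ℝ)))
  refine h2.congr_fderiv ?_
  refine ContinuousLinearMap.ext fun v => ?_
  rw [pairing_apply]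
  simp [laplaceKernel]
  ring

lemma hasFDerivAt_laplaceDensity (k b : ℕ) {p : ℝ × ℝ} (hp : 0 < p.1) :
    HasFDerivAt (fun p : ℝ × ℝ => laplaceDensity k b p.1 p.2)
      (pairing (-laplaceDensity (k + 1) b p.1 p.2) (laplaceDensity k (b + 1) p.1 p.2)) p := by
  have hp2 : 0 < p.1 / 2 := by positivity
  have hopen : IsOpen {q : ℝ × ℝ | p.1 / 2 < q.1} := isOpen_lt continuous_const continuous_fst
  have h := hasFDerivAt_integral_of_dominated_of_fderiv_le (𝕜 := ℝ) (x₀ := p)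
    (μ := volume.restrict (Set.Ioi (0 : ℝ)))
    (F := fun (q : ℝ × ℝ) s => laplaceKernel k b q.1 q.2 s)
    (F' := fun (q : ℝ × ℝ) s =>
      pairing (-laplaceKernel (k + 1) b q.1 q.2 s) (laplaceKernel k (b + 1) q.1 q.2 s))
    (bound := fun s =>
      b.factorial * Real.exp 1 * (Real.exp (-(p.1 / 2 * s)) * s ^ (k + 1 + b + 2))
        + (b + 1).factorial * Real.exp 1 * (Real.exp (-(p.1 / 2 * s)) * s ^ (k + (b + 1) + 2)))
    (hopen.mem_nhds (show p.1 / 2 < p.1 by linarith))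
    (Filter.Eventually.of_forall fun q =>
      (measurable_laplaceKernel k b q.1 q.2).aestronglyMeasurable)
    (integrableOn_laplaceKernel k b hp p.2) ?_ ?_ ?_ ?_
  · refine h.congr_fderiv ?_
    have hi1 : Integrable (fun s => -laplaceKernel (k + 1) b p.1 p.2 s)
        (volume.restrict (Set.Ioi 0)) := (integrableOn_laplaceKernel (k + 1) b hp p.2).neg
    have hi2 := integrableOn_laplaceKernel k (b + 1) hp p.2
    unfold pairing
    rw [integral_add, ContinuousLinearMap.integral_comp_comm _ hi1,
      ContinuousLinearMap.integral_comp_comm _ hi2]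
    · rw [integral_neg]; rfl
    · exact ContinuousLinearMap.integrable_comp _ hi1
    · exact ContinuousLinearMap.integrable_comp _ hi2
  · unfold pairing
    exact ((ContinuousLinearMap.continuous _).comp_aestronglyMeasurable
      (measurable_laplaceKernel (k + 1) b p.1 p.2).neg.aestronglyMeasurable).add
      ((ContinuousLinearMap.continuous _).comp_aestronglyMeasurable
      (measurable_laplaceKernel k (b + 1) p.1 p.2).aestronglyMeasurable)
  · filter_upwards [ae_restrict_mem measurableSet_Ioi] with s hs q hq
    refine (norm_pairing_le _ _).trans (add_le_add ?_ ?_)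
    · rw [norm_neg]
      exact norm_laplaceKernel_le (k + 1) b (le_of_lt hq) hs q.2
    · exact norm_laplaceKernel_le k (b + 1) (le_of_lt hq) hs q.2
  · exact ((integrableOn_exp_neg_mul_pow _ hp2).const_mul _).add
      ((integrableOn_exp_neg_mul_pow _ hp2).const_mul _)
  · exact Filter.Eventually.of_forall fun s q _ => hasFDerivAt_laplaceKernel k b s q

lemma hasDerivAt_laplaceDensity_left (k b : ℕ) {u : ℝ} (hu : 0 < u) (ξ : ℝ) :
    HasDerivAt (fun v => laplaceDensity k b v ξ) (-laplaceDensity (k + 1) b u ξ) u := by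
  have h := (hasFDerivAt_laplaceDensity k b (p := (u, ξ)) hu).comp_hasDerivAt u
    ((hasDerivAt_id u).prodMk (hasDerivAt_const u ξ))
  refine h.congr_deriv ?_
  simp [pairing_apply]

lemma hasDerivAt_laplaceDensity_right (k b : ℕ) {u : ℝ} (hu : 0 < u) (ξ : ℝ) :
    HasDerivAt (fun η => laplaceDensity k b u η) (laplaceDensity k (b + 1) u ξ) ξ := by
  have h := (hasFDerivAt_laplaceDensity k b (p := (u, ξ)) hu).comp_hasDerivAt ξ
    ((hasDerivAt_const ξ u).prodMk (hasDerivAt_id ξ))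
  refine h.congr_deriv ?_
  simp [pairing_apply]

lemma isOpen_fst_pos : IsOpen {p : ℝ × ℝ | 0 < p.1} := isOpen_lt continuous_const continuous_fst

lemma contDiffOn_laplaceDensity (n k b : ℕ) :
    ContDiffOn ℝ n (fun p : ℝ × ℝ => laplaceDensity k b p.1 p.2) {p | 0 < p.1} := by
  induction n generalizing k b with
  | zero =>
    refine contDiffOn_zero.mpr fun p hp => ?_
    exact (hasFDerivAt_laplaceDensity k b hp).continuousAt.continuousWithinAt
  | succ n ih =>
    rw [Nat.cast_add, Nat.cast_one, contDiffOn_succ_iff_fderiv_of_isOpen isOpen_fst_pos]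
    refine ⟨fun p hp =>
      (hasFDerivAt_laplaceDensity k b hp).differentiableAt.differentiableWithinAt,
      fun h => by simp at h, ?_⟩
    have h : ContDiffOn ℝ n (fun p : ℝ × ℝ =>
        pairing (-laplaceDensity (k + 1) b p.1 p.2) (laplaceDensity k (b + 1) p.1 p.2))
        {p | 0 < p.1} :=
      ((ContinuousLinearMap.contDiff _).comp_contDiffOn (ih (k + 1) b).neg).add
        ((ContinuousLinearMap.contDiff _).comp_contDiffOn (ih k (b + 1)))
    exact h.congr fun p hp => (hasFDerivAt_laplaceDensity k b hp).fderiv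

/-! ### The symbol class -/

/-- The functions `(u/(u+i))^{j+1} uᵏ ξᵇ ∫ e^{-us} sᵏ ∂_ξᵇ R(s, ξ) ds`. -/
def symbolGenerator (j k b : ℕ) (u ξ : ℝ) : ℂ :=
  ((u : ℂ) / (u + I)) ^ (j + 1) * ((u : ℂ) ^ k * (ξ : ℂ) ^ b) * laplaceDensity k b u ξ

/-- The span of the generators, which is stable under `u∂_u` and `ξ∂_ξ`. -/
def symbolSpan : Submodule ℂ (ℝ → ℝ → ℂ) :=
  Submodule.span ℂ (Set.range fun i : ℕ × ℕ × ℕ => symbolGenerator i.1 i.2.1 i.2.2)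

lemma symbolGenerator_mem (j k b : ℕ) : symbolGenerator j k b ∈ symbolSpan :=
  Submodule.subset_span ⟨(j, k, b), rfl⟩

lemma ofReal_add_I_ne_zero (u : ℝ) : (u : ℂ) + I ≠ 0 := by
  intro h
  simpa using congrArg Complex.im h

lemma hasDerivAt_ofReal_pow (k : ℕ) {u : ℝ} (hu : u ≠ 0) :
    HasDerivAt (fun v : ℝ => (v : ℂ) ^ k) ((u : ℂ)⁻¹ * (k * (u : ℂ) ^ k)) u := by
  have hu' : (u : ℂ) ≠ 0 := by exact_mod_cast hu
  refine ((hasDerivAt_pow k (u : ℂ)).comp_ofReal).congr_deriv ?_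
  cases k with
  | zero => simp
  | succ k => rw [Nat.add_sub_cancel, pow_succ]; field_simp

lemma hasDerivAt_div_add_I_pow (j : ℕ) {u : ℝ} (hu : u ≠ 0) :
    HasDerivAt (fun v : ℝ => ((v : ℂ) / (v + I)) ^ (j + 1))
      ((u : ℂ)⁻¹ * ((j + 1) * (((u : ℂ) / (u + I)) ^ (j + 1) - ((u : ℂ) / (u + I)) ^ (j + 2)))) u := by
  have hu' : (u : ℂ) ≠ 0 := by exact_mod_cast hu
  have hI := ofReal_add_I_ne_zero u
  have h : HasDerivAt (fun z : ℂ => (z / (z + I)) ^ (j + 1))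
      (((j + 1 : ℕ) : ℂ) * ((u : ℂ) / (u + I)) ^ j * ((1 * ((u : ℂ) + I) - u * 1) / (u + I) ^ 2))
      (u : ℂ) :=
    ((hasDerivAt_id' (u : ℂ)).div ((hasDerivAt_id' (u : ℂ)).add_const I) hI).pow (j + 1)
  refine h.comp_ofReal.congr_deriv ?_
  have hq : (1 * ((u : ℂ) + I) - u * 1) / (u + I) ^ 2
      = (u : ℂ)⁻¹ * ((u : ℂ) / (u + I) * (1 - (u : ℂ) / (u + I))) := by
    field_simp
  rw [hq]
  push_cast
  ring

lemma hasDerivAt_symbolGenerator_left (j k b : ℕ) {u : ℝ} (hu : 0 < u) (ξ : ℝ) :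
    HasDerivAt (fun v => symbolGenerator j k b v ξ)
      ((u : ℂ)⁻¹ * ((j + 1 + k : ℂ) * symbolGenerator j k b u ξ
        - (j + 1 : ℂ) * symbolGenerator (j + 1) k b u ξ - symbolGenerator j (k + 1) b u ξ)) u := by
  have hu' : (u : ℂ) ≠ 0 := by exact_mod_cast hu.ne'
  refine (((hasDerivAt_div_add_I_pow j hu.ne').mul
    ((hasDerivAt_ofReal_pow k hu.ne').mul_const ((ξ : ℂ) ^ b))).mul
    (hasDerivAt_laplaceDensity_left k b hu ξ)).congr_deriv ?_
  simp only [symbolGenerator, Pi.mul_apply]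
  rw [pow_succ (u : ℂ) k]
  field_simp
  ring

lemma hasDerivAt_symbolGenerator_right (j k b : ℕ) {u ξ : ℝ} (hu : 0 < u) (hξ : ξ ≠ 0) :
    HasDerivAt (fun η => symbolGenerator j k b u η)
      ((ξ : ℂ)⁻¹ * ((b : ℂ) * symbolGenerator j k b u ξ + symbolGenerator j k (b + 1) u ξ)) ξ := by
  have hξ' : (ξ : ℂ) ≠ 0 := by exact_mod_cast hξ
  refine ((((hasDerivAt_ofReal_pow b hξ).const_mul ((u : ℂ) ^ k)).const_mul
    (((u : ℂ) / (u + I)) ^ (j + 1))).mul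
    (hasDerivAt_laplaceDensity_right k b hu ξ)).congr_deriv ?_
  simp only [symbolGenerator]
  rw [pow_succ (ξ : ℂ) b]
  field_simp

lemma exists_hasDerivAt_left_of_mem_symbolSpan {g : ℝ → ℝ → ℂ} (hg : g ∈ symbolSpan) :
    ∃ g' ∈ symbolSpan, ∀ u ξ : ℝ, 0 < u →
      HasDerivAt (fun v => g v ξ) ((u : ℂ)⁻¹ * g' u ξ) u := by
  induction hg using Submodule.span_induction with
  | mem g hg =>
    obtain ⟨⟨j, k, b⟩, rfl⟩ := hg
    exact ⟨(j + 1 + k : ℂ) • symbolGenerator j k b - (j + 1 : ℂ) • symbolGenerator (j + 1) k b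
      - symbolGenerator j (k + 1) b,
      sub_mem (sub_mem (Submodule.smul_mem _ _ (symbolGenerator_mem _ _ _))
        (Submodule.smul_mem _ _ (symbolGenerator_mem _ _ _))) (symbolGenerator_mem _ _ _),
      fun u ξ hu => hasDerivAt_symbolGenerator_left j k b hu ξ⟩
  | zero => exact ⟨0, zero_mem _, fun u ξ _ => by simpa using hasDerivAt_const u (0 : ℂ)⟩
  | add g₁ g₂ _ _ h₁ h₂ =>
    obtain ⟨g₁', hm₁, hd₁⟩ := h₁
    obtain ⟨g₂', hm₂, hd₂⟩ := h₂
    exact ⟨g₁' + g₂', add_mem hm₁ hm₂, fun u ξ hu =>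
      ((hd₁ u ξ hu).add (hd₂ u ξ hu)).congr_deriv (by simp only [Pi.add_apply]; ring)⟩
  | smul c g _ h =>
    obtain ⟨g', hm, hd⟩ := h
    exact ⟨c • g', Submodule.smul_mem _ _ hm, fun u ξ hu =>
      ((hd u ξ hu).const_mul c).congr_deriv
        (by simp only [Pi.smul_apply, smul_eq_mul]; ring)⟩

lemma exists_hasDerivAt_right_of_mem_symbolSpan {g : ℝ → ℝ → ℂ} (hg : g ∈ symbolSpan) :
    ∃ g' ∈ symbolSpan, ∀ u ξ : ℝ, 0 < u → ξ ≠ 0 →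
      HasDerivAt (fun η => g u η) ((ξ : ℂ)⁻¹ * g' u ξ) ξ := by
  induction hg using Submodule.span_induction with
  | mem g hg =>
    obtain ⟨⟨j, k, b⟩, rfl⟩ := hg
    exact ⟨(b : ℂ) • symbolGenerator j k b + symbolGenerator j k (b + 1),
      add_mem (Submodule.smul_mem _ _ (symbolGenerator_mem _ _ _)) (symbolGenerator_mem _ _ _),
      fun u ξ hu hξ => hasDerivAt_symbolGenerator_right j k b hu hξ⟩
  | zero => exact ⟨0, zero_mem _, fun u ξ _ _ => by simpa using hasDerivAt_const ξ (0 : ℂ)⟩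
  | add g₁ g₂ _ _ h₁ h₂ =>
    obtain ⟨g₁', hm₁, hd₁⟩ := h₁
    obtain ⟨g₂', hm₂, hd₂⟩ := h₂
    exact ⟨g₁' + g₂', add_mem hm₁ hm₂, fun u ξ hu hξ =>
      ((hd₁ u ξ hu hξ).add (hd₂ u ξ hu hξ)).congr_deriv (by simp only [Pi.add_apply]; ring)⟩
  | smul c g _ h =>
    obtain ⟨g', hm, hd⟩ := h
    exact ⟨c • g', Submodule.smul_mem _ _ hm, fun u ξ hu hξ =>
      ((hd u ξ hu hξ).const_mul c).congr_deriv
        (by simp only [Pi.smul_apply, smul_eq_mul]; ring)⟩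

/-- Functions agreeing on the open quadrant with an element of the symbol span. -/
def IsSymbol (G : ℝ → ℝ → ℂ) : Prop :=
  ∃ g ∈ symbolSpan, ∀ u ξ : ℝ, 0 < u → 0 < ξ → G u ξ = g u ξ

lemma IsSymbol.DU {G : ℝ → ℝ → ℂ} (hG : IsSymbol G) : IsSymbol (DU G) := by
  obtain ⟨g, hg, hGg⟩ := hG
  obtain ⟨g', hg', hd⟩ := exists_hasDerivAt_left_of_mem_symbolSpan hg
  refine ⟨g', hg', fun u ξ hu hξ => ?_⟩
  have hu' : (u : ℂ) ≠ 0 := by exact_mod_cast hu.ne'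
  have h : HasDerivAt (fun v => G v ξ) ((u : ℂ)⁻¹ * g' u ξ) u :=
    (hd u ξ hu).congr_of_eventuallyEq (by
      filter_upwards [lt_mem_nhds hu] with v hv using hGg v ξ hv hξ)
  rw [_root_.DU, h.deriv, mul_inv_cancel_left₀ hu']

lemma IsSymbol.DXI {G : ℝ → ℝ → ℂ} (hG : IsSymbol G) : IsSymbol (DXI G) := by
  obtain ⟨g, hg, hGg⟩ := hG
  obtain ⟨g', hg', hd⟩ := exists_hasDerivAt_right_of_mem_symbolSpan hg
  refine ⟨g', hg', fun u ξ hu hξ => ?_⟩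
  have hξ' : (ξ : ℂ) ≠ 0 := by exact_mod_cast hξ.ne'
  have h : HasDerivAt (fun η => G u η) ((ξ : ℂ)⁻¹ * g' u ξ) ξ :=
    (hd u ξ hu hξ.ne').congr_of_eventuallyEq (by
      filter_upwards [lt_mem_nhds hξ] with η hη using hGg u η hu hη)
  rw [_root_.DXI, h.deriv, mul_inv_cancel_left₀ hξ']

lemma IsSymbol.iterate {G : ℝ → ℝ → ℂ} (hG : IsSymbol G) (a b : ℕ) :
    IsSymbol (_root_.DU^[a] (_root_.DXI^[b] G)) := by
  induction a with
  | zero =>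
    induction b with
    | zero => exact hG
    | succ b ih =>
      rw [Function.iterate_succ_apply']
      exact IsSymbol.DXI ih
  | succ a ih =>
    rw [Function.iterate_succ_apply']
    exact IsSymbol.DU ih

lemma norm_div_add_I_le {u : ℝ} (hu : 0 < u) :
    ‖(u : ℂ) / (u + I)‖ ≤ 1 ∧ ‖(u : ℂ) / (u + I)‖ ≤ 2 * u / (1 + u) := by
  have hn : ‖(u : ℂ) + I‖ ^ 2 = u ^ 2 + 1 := by
    rw [← Complex.normSq_eq_norm_sq]; simp [Complex.normSq_apply]; ring
  have h1 : u ≤ ‖(u : ℂ) + I‖ := by nlinarith [norm_nonneg ((u : ℂ) + I)]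
  have h2 : 1 + u ≤ 2 * ‖(u : ℂ) + I‖ := by
    nlinarith [norm_nonneg ((u : ℂ) + I), sq_nonneg (u - 1)]
  have h0 : 0 < ‖(u : ℂ) + I‖ := hu.trans_le h1
  rw [norm_div, Complex.norm_real, Real.norm_of_nonneg hu.le]
  refine ⟨(div_le_one h0).mpr h1, ?_⟩
  rw [div_le_div_iff₀ h0 (by positivity)]
  nlinarith

lemma norm_symbolGenerator_le (j k b : ℕ) {u ξ : ℝ} (hξ : 0 < ξ) (hu : ξ ≤ u) :
    ‖symbolGenerator j k b u ξ‖ ≤ 4 * (b.factorial * Real.exp 1 * (k + b + 2).factorial) *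
      ((1 + (u⁻¹) ^ 2) * ((1 + u)⁻¹) ^ 3) := by
  have hu0 : 0 < u := hξ.trans_le hu
  obtain ⟨hy1, hy2⟩ := norm_div_add_I_le hu0
  set A : ℝ := b.factorial * Real.exp 1 * (k + b + 2).factorial with hA
  have hA0 : 0 ≤ A := by positivity
  have h1 : ‖((u : ℂ) / (u + I)) ^ (j + 1)‖ ≤ 2 * u / (1 + u) := by
    rw [pow_succ, norm_mul, norm_pow]
    exact (mul_le_of_le_one_left (norm_nonneg _) (pow_le_one₀ (norm_nonneg _) hy1)).trans hy2
  have h2 : ‖(u : ℂ) ^ k * (ξ : ℂ) ^ b‖ ≤ u ^ (k + b) := by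
    rw [norm_mul, norm_pow, norm_pow, Complex.norm_real, Complex.norm_real,
      Real.norm_of_nonneg hu0.le, Real.norm_of_nonneg hξ.le, pow_add]
    gcongr
  have h3 := norm_laplaceDensity_le k b hu0 ξ
  calc ‖symbolGenerator j k b u ξ‖
      ≤ 2 * u / (1 + u) * u ^ (k + b) *
          (b.factorial * Real.exp 1 * ((k + b + 2).factorial / u ^ (k + b + 3))) := by
        rw [symbolGenerator, norm_mul, norm_mul]
        gcongr
    _ = 2 * A * ((u⁻¹) ^ 2 * (1 + u)⁻¹) := by
        rw [hA, pow_add u (k + b) 3]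
        field_simp
    _ ≤ 2 * A * (2 * ((1 + (u⁻¹) ^ 2) * ((1 + u)⁻¹) ^ 3)) := by
        refine mul_le_mul_of_nonneg_left ?_ (by positivity)
        have h4 : (1 + u) ^ 2 ≤ 2 * (u ^ 2 + 1) := by nlinarith [sq_nonneg (u - 1)]
        have h5 : (1 + (u⁻¹) ^ 2) * ((1 + u)⁻¹) ^ 3 = (u ^ 2 + 1) / (u ^ 2 * (1 + u) ^ 3) := by
          field_simp
        have h6 : (u⁻¹) ^ 2 * (1 + u)⁻¹ = (1 + u) ^ 2 / (u ^ 2 * (1 + u) ^ 3) := by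
          field_simp
        rw [h5, h6, ← mul_div_assoc]
        gcongr
    _ = _ := by ring

lemma exists_bound_of_mem_symbolSpan {g : ℝ → ℝ → ℂ} (hg : g ∈ symbolSpan) :
    ∃ C : ℝ, ∀ u ξ : ℝ, 0 < ξ → ξ ≤ u →
      ‖g u ξ‖ ≤ C * ((1 + (u⁻¹) ^ 2) * ((1 + u)⁻¹) ^ 3) := by
  induction hg using Submodule.span_induction with
  | mem g hg =>
    obtain ⟨⟨j, k, b⟩, rfl⟩ := hg
    exact ⟨_, fun u ξ hξ hu => norm_symbolGenerator_le j k b hξ hu⟩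
  | zero => exact ⟨0, fun u ξ _ _ => by simp⟩
  | add g₁ g₂ _ _ h₁ h₂ =>
    obtain ⟨C₁, h₁⟩ := h₁
    obtain ⟨C₂, h₂⟩ := h₂
    refine ⟨C₁ + C₂, fun u ξ hξ hu => ?_⟩
    rw [add_mul]
    exact (norm_add_le _ _).trans (add_le_add (h₁ u ξ hξ hu) (h₂ u ξ hξ hu))
  | smul c g _ h =>
    obtain ⟨C, h⟩ := h
    refine ⟨‖c‖ * C, fun u ξ hξ hu => ?_⟩
    rw [Pi.smul_apply, Pi.smul_apply, norm_smul, mul_assoc]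
    exact mul_le_mul_of_nonneg_left (h u ξ hξ hu) (norm_nonneg c)

lemma IsSymbol.exists_bound {G : ℝ → ℝ → ℂ} (hG : IsSymbol G) :
    ∃ C : ℝ, 0 < C ∧ ∀ u ξ : ℝ, 0 < ξ → ξ ≤ 1 → ξ ≤ u →
      ‖G u ξ‖ ≤ C * (1 + (u⁻¹) ^ 2) * ((1 + u)⁻¹) ^ 3 := by
  obtain ⟨g, hg, hGg⟩ := hG
  obtain ⟨C, hC⟩ := exists_bound_of_mem_symbolSpan hg
  refine ⟨max C 1, by positivity, fun u ξ hξ _ hu => ?_⟩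
  have hu0 : 0 < u := hξ.trans_le hu
  rw [hGg u ξ hu0 hξ, mul_assoc]
  refine (hC u ξ hξ hu).trans ?_
  gcongr
  exact le_max_left _ _

/-- The correction `ρ₁`. -/
def jostCorrection (u ξ : ℝ) : ℂ := I * ((u : ℂ) / (u + I)) * laplaceDensity 0 0 u ξ

lemma isSymbol_jostCorrection : IsSymbol jostCorrection :=
  ⟨I • symbolGenerator 0 0 0, Submodule.smul_mem _ _ (symbolGenerator_mem _ _ _),
    fun u ξ _ _ => by simp [jostCorrection, symbolGenerator, mul_assoc]⟩

lemma contDiffOn_jostCorrection :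
    ContDiffOn ℝ (⊤ : ℕ∞) (fun p : ℝ × ℝ => jostCorrection p.1 p.2) {p | 0 < p.1} := by
  rw [contDiffOn_infty]
  intro n
  have h : ContDiff ℝ n fun p : ℝ × ℝ => (p.1 : ℂ) := Complex.ofRealCLM.contDiff.comp contDiff_fst
  have h2 : ContDiff ℝ n fun p : ℝ × ℝ => (p.1 : ℂ) / (p.1 + I) := by
    simp only [div_eq_mul_inv]
    exact h.mul ((h.add contDiff_const).inv fun p => ofReal_add_I_ne_zero p.1)
  exact (contDiff_const.mul h2).contDiffOn.mul (contDiffOn_laplaceDensity n 0 0)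

/-! ### The differential equation -/

/-- The moments `∫₀^∞ e^{-us} sᵏ (1 + ξ² R(s, ξ)) ds`. -/
def laplaceMoment (k : ℕ) (u ξ : ℝ) : ℂ :=
  k.factorial / (u : ℂ) ^ (k + 1) + (ξ : ℂ) ^ 2 * laplaceDensity k 0 u ξ

/-- The kernel of `laplaceMoment`. -/
def momentKernel (k : ℕ) (u ξ s : ℝ) : ℂ :=
  ((Real.exp (-(u * s)) * s ^ k : ℝ) : ℂ) * neumann (-(ξ : ℂ) ^ 2) s

lemma momentKernel_eq (k : ℕ) (u ξ s : ℝ) :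
    momentKernel k u ξ s =
      ((Real.exp (-(u * s)) * s ^ k : ℝ) : ℂ) + (ξ : ℂ) ^ 2 * laplaceKernel k 0 u ξ s := by
  rw [momentKernel, neumann_eq_one_add, laplaceKernel, jostDensityDeriv, iteratedDeriv_zero]
  ring

lemma integrableOn_momentKernel (k : ℕ) {u : ℝ} (hu : 0 < u) (ξ : ℝ) :
    IntegrableOn (momentKernel k u ξ) (Set.Ioi 0) := by
  simp_rw [funext (momentKernel_eq k u ξ)]
  exact (integrableOn_exp_neg_mul_pow k hu).ofReal.add
    ((integrableOn_laplaceKernel k 0 hu ξ).const_mul _)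

lemma integral_momentKernel (k : ℕ) {u : ℝ} (hu : 0 < u) (ξ : ℝ) :
    ∫ s in Set.Ioi (0 : ℝ), momentKernel k u ξ s = laplaceMoment k u ξ := by
  have hi : Integrable (fun s : ℝ => ((Real.exp (-(u * s)) * s ^ k : ℝ) : ℂ))
      (volume.restrict (Set.Ioi 0)) := (integrableOn_exp_neg_mul_pow k hu).ofReal
  simp_rw [momentKernel_eq]
  rw [integral_add hi ((integrableOn_laplaceKernel k 0 hu ξ).const_mul _), integral_const_mul,
    integral_complex_ofReal,
    integral_pow_mul_exp_neg_Ioi k hu, laplaceMoment, laplaceDensity]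
  push_cast
  rfl

lemma hasDerivAt_laplaceMoment (k : ℕ) {u : ℝ} (hu : 0 < u) (ξ : ℝ) :
    HasDerivAt (fun v => laplaceMoment k v ξ) (-laplaceMoment (k + 1) u ξ) u := by
  have hu' : (u : ℂ) ≠ 0 := by exact_mod_cast hu.ne'
  have h1 : HasDerivAt (fun v : ℝ => (k.factorial : ℂ) / (v : ℂ) ^ (k + 1))
      (-((k + 1).factorial / (u : ℂ) ^ (k + 2))) u := by
    refine ((hasDerivAt_const u (k.factorial : ℂ)).div
      (hasDerivAt_ofReal_pow (k + 1) hu.ne') (pow_ne_zero _ hu')).congr_deriv ?_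
    rw [Nat.factorial_succ]
    push_cast
    field_simp
    ring
  refine (h1.add ((hasDerivAt_laplaceDensity_left k 0 hu ξ).const_mul ((ξ : ℂ) ^ 2))).congr_deriv ?_
  rw [laplaceMoment]
  ring

lemma tendsto_exp_neg_mul_pow (n : ℕ) {u : ℝ} (hu : 0 < u) :
    Tendsto (fun s : ℝ => Real.exp (-(u * s)) * s ^ n) atTop (nhds 0) := by
  have h := ((Real.tendsto_pow_mul_exp_neg_atTop_nhds_zero n).comp
    (tendsto_id.const_mul_atTop hu)).const_mul ((u ^ n)⁻¹)
  rw [mul_zero] at h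
  refine h.congr fun s => ?_
  simp only [Function.comp_apply, id, mul_pow]
  field_simp

lemma laplaceMoment_relation {u : ℝ} (hu : 0 < u) (ξ : ℝ) :
    2 * laplaceMoment 0 u ξ
      - ((u : ℂ) ^ 2 + (ξ : ℂ) ^ 2) * (laplaceMoment 2 u ξ - 2 * I * laplaceMoment 1 u ξ)
      = 2 * I := by
  set w : ℂ := -(ξ : ℂ) ^ 2 with hw
  set F := neumann w with hF
  set G : ℝ → ℂ := fun s => w * weightedMean F s with hG
  have hFc : Continuous F := continuous_neumann _
  have hGc : Continuous G := (continuous_weightedMean hFc).const_mul _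
  set W : ℝ → ℂ := fun s => ((Real.exp (-(u * s)) : ℝ) : ℂ) *
    ((2 * (s : ℂ) - 2 * I) * F s + jostQ s * G s + u * (jostQ s * F s)) with hW
  have hWc : Continuous W := by
    have := continuous_jostQ
    fun_prop
  have hderiv : ∀ s ∈ Set.Ioi (0 : ℝ), HasDerivAt W
      (2 * momentKernel 0 u ξ s - ((u : ℂ) ^ 2 + (ξ : ℂ) ^ 2) *
        (momentKernel 2 u ξ s - 2 * I * momentKernel 1 u ξ s)) s := by
    intro s hs
    have hs0 : s ≠ 0 := ne_of_gt hs
    have hQ0 := jostQ_ne_zero hs0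
    have h1 : HasDerivAt F (G s) s := hasDerivAt_neumann _ s
    have h2 : HasDerivAt G (w * F s - 2 * (2 * (s : ℂ) - 2 * I) / jostQ s * G s) s := by
      refine ((hasDerivAt_weightedMean hFc hs0).const_mul w).congr_deriv ?_
      simp only [hG]; ring
    have h3 : HasDerivAt (fun s => ((Real.exp (-(u * s)) : ℝ) : ℂ))
        ((Real.exp (-(u * s)) * -u : ℝ) : ℂ) s := by
      refine HasDerivAt.ofReal_comp ?_
      simpa using ((hasDerivAt_id s).const_mul u).neg.exp
    have h4 := hasDerivAt_jostQ s
    have h5 : HasDerivAt (fun s : ℝ => 2 * (s : ℂ) - 2 * I) 2 s := by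
      simpa using (((hasDerivAt_id (s : ℂ)).const_mul 2).sub_const (2 * I)).comp_ofReal
    refine (h3.mul (((h5.mul h1).add (h4.mul h2)).add ((h4.mul h1).const_mul (u : ℂ)))).congr_deriv ?_
    simp only [Pi.add_apply, Pi.mul_apply, momentKernel, ← hw, ← hF]
    rw [mul_sub (jostQ s), ← mul_assoc (jostQ s) (2 * _ / _), mul_div_cancel₀ _ hQ0]
    simp only [jostQ, hw]
    push_cast
    ring
  have hlim : Tendsto W atTop (nhds 0) := by
    have hbound : ∀ s : ℝ, 0 ≤ s → ‖W s‖ ≤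
        (2 + 2 * u) * (Real.exp (-(u * s)) * s ^ 1) + 2 * (Real.exp (-(u * s)) * s ^ 0)
        + (2 * ξ ^ 2 + u) * (Real.exp (-(u * s)) * s ^ 2)
        + ξ ^ 2 * (Real.exp (-(u * s)) * s ^ 3) := by
      intro s hs
      have hF1 : ‖F s‖ ≤ 1 := by
        simpa using norm_neumann_le (ξ : ℂ) hs
      have hG1 : ‖G s‖ ≤ ξ ^ 2 * s := by
        have h := norm_weightedMean_neumann_le (ξ : ℂ) hs
        simp only [Complex.ofReal_im, abs_zero, zero_mul, Real.exp_zero, one_mul] at h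
        simp only [hG, norm_mul, hw, norm_neg, norm_pow, Complex.norm_real, Real.norm_eq_abs, sq_abs]
        gcongr
      have hQ1 : ‖jostQ s‖ ≤ s * (s + 2) := by
        rw [jostQ, norm_mul, Complex.norm_real, Real.norm_of_nonneg hs]
        gcongr
        refine (norm_sub_le _ _).trans_eq ?_
        simp [abs_of_nonneg hs]
      have hL1 : ‖2 * (s : ℂ) - 2 * I‖ ≤ 2 * s + 2 := by
        refine (norm_sub_le _ _).trans_eq ?_
        simp [abs_of_nonneg hs]
      calc ‖W s‖ ≤ Real.exp (-(u * s)) *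
            ((2 * s + 2) * 1 + s * (s + 2) * (ξ ^ 2 * s) + u * (s * (s + 2) * 1)) := by
            simp only [hW]
            rw [norm_mul, Complex.norm_real, Real.norm_of_nonneg (Real.exp_pos _).le]
            gcongr
            refine (norm_add₃_le).trans ?_
            simp only [norm_mul, Complex.norm_real, Real.norm_of_nonneg hu.le] at hL1 ⊢
            gcongr
        _ = _ := by ring
    refine squeeze_zero_norm' (by filter_upwards [eventually_ge_atTop 0] with s hs using hbound s hs) ?_
    simpa using ((((tendsto_exp_neg_mul_pow 1 hu).const_mul (2 + 2 * u)).add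
      ((tendsto_exp_neg_mul_pow 0 hu).const_mul 2)).add
      ((tendsto_exp_neg_mul_pow 2 hu).const_mul (2 * ξ ^ 2 + u))).add
      ((tendsto_exp_neg_mul_pow 3 hu).const_mul (ξ ^ 2))
  have hi := fun k => integrableOn_momentKernel k hu ξ
  have h_int := ((hi 0).const_mul 2).sub
    (((hi 2).sub ((hi 1).const_mul (2 * I))).const_mul ((u : ℂ) ^ 2 + (ξ : ℂ) ^ 2))
  have hFTC := integral_Ioi_of_hasDerivAt_of_tendsto hWc.continuousWithinAt hderiv h_int hlim
  have hi21 : IntegrableOn (fun s => momentKernel 2 u ξ s - 2 * I * momentKernel 1 u ξ s)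
      (Set.Ioi 0) := (hi 2).sub ((hi 1).const_mul (2 * I))
  rw [integral_sub ((hi 0).const_mul 2) (hi21.const_mul _), integral_const_mul, integral_const_mul,
    integral_sub (hi 2) ((hi 1).const_mul (2 * I)), integral_const_mul,
    integral_momentKernel 0 hu, integral_momentKernel 1 hu, integral_momentKernel 2 hu] at hFTC
  rw [hFTC]
  have hF0 : F 0 = 1 := by rw [hF, neumann_eq]; simp [volterra]
  simp [hW, hF0, jostQ]

/-- The amplitude `e^{-iu} f`. -/
def jostAmplitude (u ξ : ℝ) : ℂ := 1 + I * laplaceMoment 0 u ξ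

lemma hplus_mul_one_add {u : ℝ} (hu : 0 < u) (ξ : ℝ) :
    hplus u * (1 + (ξ : ℂ) ^ 2 * jostCorrection u ξ) = exp (I * u) * jostAmplitude u ξ := by
  have hu' : (u : ℂ) ≠ 0 := by exact_mod_cast hu.ne'
  have hI := ofReal_add_I_ne_zero u
  rw [hplus, jostCorrection, jostAmplitude, laplaceMoment, mul_assoc]
  congr 1
  simp only [Nat.factorial_zero, Nat.cast_one, zero_add, pow_one]
  field_simp
  ring

lemma hasDerivAt_exp_mul_comp {A : ℝ → ℂ} {A' : ℂ} {ξ x : ℝ} (hA : HasDerivAt A A' (x * ξ)) :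
    HasDerivAt (fun y : ℝ => exp (I * ((y * ξ : ℝ) : ℂ)) * A (y * ξ))
      (exp (I * ((x * ξ : ℝ) : ℂ)) * (ξ * (I * A (x * ξ) + A'))) x := by
  have h0 : HasDerivAt (fun y : ℝ => y * ξ) ξ x := by
    simpa using (hasDerivAt_id x).mul_const ξ
  have h1 := ((h0.ofReal_comp).const_mul I).cexp
  have h2 := hA.scomp x h0
  refine (h1.mul h2).congr_deriv ?_
  simp only [Function.comp_apply, Complex.real_smul]
  ring

lemma jost_equation {ξ x : ℝ} (hξ : 0 < ξ) (hx : 0 < x) :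
    - deriv (deriv (fun y : ℝ =>
        hplus (y * ξ) * (1 + (ξ : ℂ) ^ 2 * jostCorrection (y * ξ) ξ))) x
      + ((2 / (1 + x ^ 2) : ℝ) : ℂ) *
        (hplus (x * ξ) * (1 + (ξ : ℂ) ^ 2 * jostCorrection (x * ξ) ξ))
      = (ξ : ℂ) ^ 2 * (hplus (x * ξ) * (1 + (ξ : ℂ) ^ 2 * jostCorrection (x * ξ) ξ)) := by
  have hd1 : ∀ y : ℝ, 0 < y → HasDerivAt
      (fun y : ℝ => hplus (y * ξ) * (1 + (ξ : ℂ) ^ 2 * jostCorrection (y * ξ) ξ))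
      (exp (I * ((y * ξ : ℝ) : ℂ)) *
        (ξ * (I * jostAmplitude (y * ξ) ξ - I * laplaceMoment 1 (y * ξ) ξ))) y := by
    intro y hy
    have hA : HasDerivAt (fun v => jostAmplitude v ξ) (I * -laplaceMoment 1 (y * ξ) ξ) (y * ξ) :=
      ((hasDerivAt_laplaceMoment 0 (mul_pos hy hξ) ξ).const_mul I).const_add 1
    refine ((hasDerivAt_exp_mul_comp hA).congr_of_eventuallyEq ?_).congr_deriv (by ring)
    filter_upwards [lt_mem_nhds hy] with z hz using hplus_mul_one_add (mul_pos hz hξ) ξ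
  have hu := mul_pos hx hξ
  have hA2 : HasDerivAt
      (fun v => (ξ : ℂ) * (I * jostAmplitude v ξ - I * laplaceMoment 1 v ξ))
      (ξ * (I * (I * -laplaceMoment 1 (x * ξ) ξ) - I * -laplaceMoment 2 (x * ξ) ξ)) (x * ξ) :=
    (((((hasDerivAt_laplaceMoment 0 hu ξ).const_mul I).const_add 1).const_mul I).sub
      ((hasDerivAt_laplaceMoment 1 hu ξ).const_mul I)).const_mul _
  have hd2 := (hasDerivAt_exp_mul_comp hA2).congr_of_eventuallyEq
    (f₁ := deriv fun y : ℝ => hplus (y * ξ) * (1 + (ξ : ℂ) ^ 2 * jostCorrection (y * ξ) ξ))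
    (by filter_upwards [lt_mem_nhds hx] with z hz using (hd1 z hz).deriv)
  rw [hd2.deriv, hplus_mul_one_add hu]
  have hrel := laplaceMoment_relation hu ξ
  have hx' : (1 : ℂ) + (x : ℂ) ^ 2 ≠ 0 := by
    have : (1 : ℝ) + x ^ 2 ≠ 0 := by positivity
    exact_mod_cast this
  rw [jostAmplitude]
  push_cast at hrel ⊢
  have hkey : 2 / (1 + (x : ℂ) ^ 2) * (1 + I * laplaceMoment 0 (x * ξ) ξ)
      = (ξ : ℂ) ^ 2 * (I * laplaceMoment 2 (x * ξ) ξ + 2 * laplaceMoment 1 (x * ξ) ξ) := by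
    rw [div_mul_eq_mul_div, div_eq_iff hx']
    linear_combination I * hrel +
      (2 - 2 * (ξ : ℂ) ^ 2 * (1 + (x : ℂ) ^ 2) * laplaceMoment 1 (x * ξ) ξ) * Complex.I_sq
  linear_combination exp (I * (x * ξ)) * hkey +
    (exp (I * (x * ξ)) * (ξ : ℂ) ^ 2 *
      (-1 - I * laplaceMoment 0 (x * ξ) ξ + 2 * laplaceMoment 1 (x * ξ) ξ)) * Complex.I_sq

lemma tendsto_jostAmplitude (ξ : ℝ) : Tendsto (fun u => jostAmplitude u ξ) atTop (nhds 1) := by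
  have h1 : Tendsto (fun u : ℝ => laplaceDensity 0 0 u ξ) atTop (nhds 0) := by
    refine squeeze_zero_norm' (a := fun u : ℝ =>
      (Nat.factorial 0 : ℝ) * Real.exp 1 * ((0 + 0 + 2).factorial / u ^ (0 + 0 + 3))) ?_ ?_
    · filter_upwards [eventually_gt_atTop 0] with u hu
      exact norm_laplaceDensity_le 0 0 hu ξ
    · have := (tendsto_const_nhds (x := ((0 + 0 + 2).factorial : ℝ))).div_atTop
        (tendsto_pow_atTop (α := ℝ) (n := 0 + 0 + 3) (by norm_num))
      simpa using this.const_mul ((Nat.factorial 0 : ℝ) * Real.exp 1)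
  have h2 : Tendsto (fun u : ℝ => (1 : ℂ) / (u : ℂ)) atTop (nhds 0) := by
    have := (Complex.continuous_ofReal.tendsto 0).comp tendsto_inv_atTop_zero
    simpa [Function.comp_def] using this
  have h3 := ((h2.add (h1.const_mul ((ξ : ℂ) ^ 2))).const_mul I).const_add 1
  simpa [jostAmplitude, laplaceMoment] using h3

/-- existence of the perturbative correction `ρ₁` in the Jost solution
expansion `f₊(x,ξ) = h₊(xξ)(1 + ξ² ρ₁(xξ,ξ))`, with symbol-type bounds. -/
theorem jost_solution_small_xi :
    ∃ (C : ℕ → ℕ → ℝ) (ρ₁ : ℝ → ℝ → ℂ),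
      (∀ a b : ℕ, 0 < C a b) ∧
      ContDiffOn ℝ (⊤ : ℕ∞) (fun p : ℝ × ℝ => ρ₁ p.1 p.2)
        {p : ℝ × ℝ | 0 < p.2 ∧ p.2 ≤ 1 ∧ p.2 ≤ p.1} ∧
      (∀ a b : ℕ, ∀ u ξ : ℝ, 0 < ξ → ξ ≤ 1 → ξ ≤ u →
        ‖(DU^[a] (DXI^[b] ρ₁)) u ξ‖ ≤ C a b * (1 + (u⁻¹) ^ 2) * ((1 + u)⁻¹) ^ 3) ∧
      (∀ ξ : ℝ, 0 < ξ → ξ ≤ 1 →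
        (∀ x : ℝ, 1 ≤ x →
          - deriv (deriv (fun y : ℝ => hplus (y * ξ) * (1 + (ξ : ℂ) ^ 2 * ρ₁ (y * ξ) ξ))) x
            + ((2 / (1 + x ^ 2) : ℝ) : ℂ) * (hplus (x * ξ) * (1 + (ξ : ℂ) ^ 2 * ρ₁ (x * ξ) ξ))
          = ((ξ : ℂ)) ^ 2 * (hplus (x * ξ) * (1 + (ξ : ℂ) ^ 2 * ρ₁ (x * ξ) ξ))) ∧
        Tendsto (fun x : ℝ =>
            Complex.exp (-(Complex.I) * x * ξ) *
              (hplus (x * ξ) * (1 + (ξ : ℂ) ^ 2 * ρ₁ (x * ξ) ξ)))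
          atTop (nhds 1)) := by
  choose C hC0 hC using fun a b => (isSymbol_jostCorrection.iterate a b).exists_bound
  refine ⟨C, jostCorrection, hC0, ?_, hC, fun ξ hξ _ => ⟨fun x hx => ?_, ?_⟩⟩
  · exact contDiffOn_jostCorrection.mono fun p hp => hp.1.trans_le hp.2.2
  · exact jost_equation hξ (zero_lt_one.trans_le hx)
  · refine ((tendsto_jostAmplitude ξ).comp (tendsto_id.atTop_mul_const hξ)).congr' ?_
    filter_upwards [eventually_gt_atTop 0] with x hx
    rw [hplus_mul_one_add (mul_pos hx hξ), ← mul_assoc, ← Complex.exp_add]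
    have h : -I * (x : ℂ) * ξ + I * ((x * ξ : ℝ) : ℂ) = 0 := by push_cast; ring
    rw [h, Complex.exp_zero, one_mul]
    rfl
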